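/- arXiv:2202.06637 — 2 statements merged into one kernel-verified Lean document; each statement's English description precedes it below -/
import Mathlib

section
/- Under the Assumption, for i ∈ {1, 2} and every m > 0 there exists a constant C = C(m) > 0 such that for all x' ∈ ℝ^d and all θ ∈ ℝ^ℓ, the i-th Fréchet derivative in θ of the invariant density exists and satisfies ‖∇_θ^i p_∞(x', θ)‖ ≤ C/(1 + |x'|^m). -/
open scoped RealInnerProductSpace

attribute [local instance] Matrix.frobeniusNormedAddCommGroup Matrix.frobeniusNormedSpace

/-- The invariant density
`p_∞(x', θ) = (det (π σ² h(θ)⁻¹))^{-1/2} exp (-(1/σ²) (x' - h(θ)⁻¹ g(θ))ᵀ h(θ) (x' - h(θ)⁻¹ g(θ)))`. -/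
noncomputable def pinf (d l : ℕ) (σ : ℝ)
    (g : EuclideanSpace ℝ (Fin l) → EuclideanSpace ℝ (Fin d))
    (h : EuclideanSpace ℝ (Fin l) → Matrix (Fin d) (Fin d) ℝ)
    (x' : EuclideanSpace ℝ (Fin d)) (θ : EuclideanSpace ℝ (Fin l)) : ℝ :=
  (((Real.pi * σ ^ 2) • (h θ)⁻¹).det) ^ (-(1 / 2 : ℝ)) *
    Real.exp (-(1 / σ ^ 2) *
      ⟪x' - Matrix.toEuclideanCLM (𝕜 := ℝ) (h θ)⁻¹ (g θ),
        Matrix.toEuclideanCLM (𝕜 := ℝ) (h θ)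
          (x' - Matrix.toEuclideanCLM (𝕜 := ℝ) (h θ)⁻¹ (g θ))⟫)

theorem entry_cd {d : ℕ} (i j : Fin d) :
    ContDiff ℝ 2 (fun M : Matrix (Fin d) (Fin d) ℝ => M i j) :=
  (LinearMap.toContinuousLinearMap (Matrix.entryLinearMap ℝ ℝ i j)).contDiff

theorem det_cd {d : ℕ} {F : Type*} [NormedAddCommGroup F] [NormedSpace ℝ F]
    (f : F → Matrix (Fin d) (Fin d) ℝ) (hf : ∀ i j, ContDiff ℝ 2 (fun x => f x i j)) :
    ContDiff ℝ 2 (fun x => (f x).det) := by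
  simp only [Matrix.det_apply']
  refine ContDiff.sum fun s _ => contDiff_const.mul (contDiff_prod fun i _ => hf _ _)

theorem adj_cd {d : ℕ} (i j : Fin d) :
    ContDiff ℝ 2 (fun M : Matrix (Fin d) (Fin d) ℝ => M.adjugate i j) := by
  simp only [Matrix.adjugate_apply]
  refine det_cd _ fun a b => ?_
  by_cases hab : a = j
  · subst hab; simp only [Matrix.updateRow_self]; exact contDiff_const
  · simp only [Matrix.updateRow_ne hab]; exact entry_cd a b

/-- The part of the density independent of the space variable. -/
noncomputable def afun (d : ℕ) (σ : ℝ)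
    (p : EuclideanSpace ℝ (Fin d) × Matrix (Fin d) (Fin d) ℝ) : ℝ :=
  (((Real.pi * σ ^ 2) • (p.2)⁻¹).det) ^ (-(1 / 2 : ℝ)) *
    Real.exp (-(1 / σ ^ 2) * ⟪p.1, Matrix.toEuclideanCLM (𝕜 := ℝ) (p.2)⁻¹ p.1⟫)

theorem inner_expand {d : ℕ} (M : Matrix (Fin d) (Fin d) ℝ) (x y : EuclideanSpace ℝ (Fin d)) :
    ⟪x, Matrix.toEuclideanCLM (𝕜 := ℝ) M y⟫ = ∑ i, ∑ j, x i * M i j * y j := by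
  simp [PiLp.inner_apply, Matrix.ofLp_toEuclideanCLM, Matrix.mulVec, dotProduct, Finset.sum_mul]
  refine Finset.sum_congr rfl fun i _ => Finset.sum_congr rfl fun j _ => by ring

theorem afun_cd (d : ℕ) (σ : ℝ) (hσ : 0 < σ) :
    ContDiffOn ℝ 2 (afun d σ) {p | 0 < p.2.det} := by
  have hdet : ContDiff ℝ 2
      (fun p : EuclideanSpace ℝ (Fin d) × Matrix (Fin d) (Fin d) ℝ => p.2.det) :=
    det_cd _ fun i j => (entry_cd i j).comp contDiff_snd
  have hdi : ContDiffOn ℝ 2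
      (fun p : EuclideanSpace ℝ (Fin d) × Matrix (Fin d) (Fin d) ℝ => (p.2.det)⁻¹)
      {p | 0 < p.2.det} := hdet.contDiffOn.inv fun p hp => ne_of_gt hp
  have hr : 0 < Real.pi * σ ^ 2 := by positivity
  unfold afun
  refine ContDiffOn.mul ?_ (ContDiffOn.exp ?_)
  · simp only [Matrix.det_smul, Matrix.det_nonsing_inv, Ring.inverse_eq_inv']
    refine ContDiffOn.rpow_const_of_ne (contDiffOn_const.mul hdi) ?_
    intro p hp
    have : 0 < p.2.det := hp
    positivity
  · simp only [inner_expand]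
    refine contDiffOn_const.mul (ContDiffOn.sum fun i _ => ContDiffOn.sum fun j _ => ?_)
    have hc : ∀ i : Fin d, ContDiff ℝ 2
      (fun p : EuclideanSpace ℝ (Fin d) × Matrix (Fin d) (Fin d) ℝ => p.1 i) := fun i =>
      (EuclideanSpace.proj (𝕜 := ℝ) i).contDiff.comp contDiff_fst
    simp only [Matrix.inv_def, Ring.inverse_eq_inv', Matrix.smul_apply, smul_eq_mul]
    exact ((hc i).contDiffOn.mul (hdi.mul ((adj_cd i j).comp contDiff_snd).contDiffOn)).mul
      (hc j).contDiffOn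

noncomputable def Acl (d : ℕ) : Matrix (Fin d) (Fin d) ℝ →L[ℝ]
    (EuclideanSpace ℝ (Fin d) →L[ℝ] EuclideanSpace ℝ (Fin d)) :=
  LinearMap.toContinuousLinearMap
    { toFun := fun M => Matrix.toEuclideanCLM (𝕜 := ℝ) M
      map_add' := fun _ _ => map_add _ _ _
      map_smul' := fun _ _ => map_smul _ _ _ }

theorem Acl_apply (d : ℕ) (M : Matrix (Fin d) (Fin d) ℝ) :
    Acl d M = Matrix.toEuclideanCLM (𝕜 := ℝ) M := rfl

def Kset (d : ℕ) (B c : ℝ) : Set (EuclideanSpace ℝ (Fin d) × Matrix (Fin d) (Fin d) ℝ) :=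
  {p | ‖p‖ ≤ B ∧ (∀ x, c * ‖x‖ ^ 2 ≤ ⟪x, Acl d p.2 x⟫) ∧ ∀ i j, p.2 i j = p.2 j i}

theorem Kset_compact (d : ℕ) (B c : ℝ) : IsCompact (Kset d B c) := by
  have : ProperSpace (EuclideanSpace ℝ (Fin d) × Matrix (Fin d) (Fin d) ℝ) :=
    FiniteDimensional.proper_real _
  refine Metric.isCompact_of_isClosed_isBounded ?_ ?_
  · refine IsClosed.inter (isClosed_le continuous_norm continuous_const) (IsClosed.inter ?_ ?_)
    · have : {p : EuclideanSpace ℝ (Fin d) × Matrix (Fin d) (Fin d) ℝ |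
          ∀ x, c * ‖x‖ ^ 2 ≤ ⟪x, Acl d p.2 x⟫} =
          ⋂ x, {p | c * ‖x‖ ^ 2 ≤ ⟪x, Acl d p.2 x⟫} := by ext; simp
      change IsClosed {p : EuclideanSpace ℝ (Fin d) × Matrix (Fin d) (Fin d) ℝ |
          ∀ x, c * ‖x‖ ^ 2 ≤ ⟪x, Acl d p.2 x⟫}
      rw [this]
      refine isClosed_iInter fun x => isClosed_le continuous_const ?_
      exact continuous_const.inner (((Acl d).continuous.comp continuous_snd).clm_apply
        continuous_const)
    · have : {p : EuclideanSpace ℝ (Fin d) × Matrix (Fin d) (Fin d) ℝ |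
          ∀ i j, p.2 i j = p.2 j i} =
          ⋂ i, ⋂ j, {p | p.2 i j = p.2 j i} := by ext; simp
      change IsClosed {p : EuclideanSpace ℝ (Fin d) × Matrix (Fin d) (Fin d) ℝ |
          ∀ i j, p.2 i j = p.2 j i}
      rw [this]
      refine isClosed_iInter fun i => isClosed_iInter fun j => isClosed_eq ?_ ?_
      · exact (entry_cd i j).continuous.comp continuous_snd
      · exact (entry_cd j i).continuous.comp continuous_snd
  · refine (Metric.isBounded_closedBall (x := 0) (r := B)).subset fun p hp => ?_
    simpa using hp.1

theorem Kset_det (d : ℕ) (B c : ℝ) (hc : 0 < c)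
    (p : EuclideanSpace ℝ (Fin d) × Matrix (Fin d) (Fin d) ℝ) (hp : p ∈ Kset d B c) :
    0 < p.2.det := by
  obtain ⟨-, h1, h2⟩ := hp
  refine Matrix.PosDef.det_pos (Matrix.PosDef.of_dotProduct_mulVec_pos ?_ ?_)
  · ext i j; simp [h2 i j]
  · intro x hx
    have h3 := h1 (WithLp.toLp 2 x)
    have h4 : 0 < ‖WithLp.toLp 2 x‖ := by
      rw [norm_pos_iff]; intro h; apply hx; simpa using h
    rw [Acl_apply, inner_expand] at h3
    have h5 : star x ⬝ᵥ p.2.mulVec x = ∑ i, ∑ j, x i * p.2 i j * x j := by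
      simp only [dotProduct, Matrix.mulVec, Finset.mul_sum, star_trivial, mul_assoc]
    rw [h5]
    have : 0 < c * ‖WithLp.toLp 2 x‖ ^ 2 := by positivity
    exact lt_of_lt_of_le this h3

theorem detU_open (d : ℕ) :
    IsOpen {p : EuclideanSpace ℝ (Fin d) × Matrix (Fin d) (Fin d) ℝ | 0 < p.2.det} :=
  isOpen_lt continuous_const
    (det_cd (fun p : EuclideanSpace ℝ (Fin d) × Matrix (Fin d) (Fin d) ℝ => p.2)
      fun i j => (entry_cd i j).comp contDiff_snd).continuous

theorem afun_bound (d : ℕ) (σ B c : ℝ) (hσ : 0 < σ) (hc : 0 < c) :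
    ∃ C : ℝ, 0 < C ∧ ∀ p ∈ Kset d B c, ∀ i ≤ 2,
      ‖iteratedFDerivWithin ℝ i (afun d σ) {p | 0 < p.2.det} p‖ ≤ C := by
  have hU := detU_open d
  have key : ∀ i : ℕ, ∃ C : ℝ, i ≤ 2 → ∀ p ∈ Kset d B c,
      ‖iteratedFDerivWithin ℝ i (afun d σ) {p | 0 < p.2.det} p‖ ≤ C := by
    intro i
    by_cases hi : i ≤ 2
    · obtain ⟨C, hC⟩ := (Kset_compact d B c).exists_bound_of_continuousOn
        (((afun_cd d σ hσ).continuousOn_iteratedFDerivWithin (m := i) (by exact_mod_cast hi)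
          hU.uniqueDiffOn).mono fun p hp => Kset_det d B c hc p hp)
      exact ⟨C, fun _ => hC⟩
    · exact ⟨0, fun h => absurd h hi⟩
  choose C hC using key
  refine ⟨1 + |C 0| + |C 1| + |C 2|, by positivity, fun p hp i hi => ?_⟩
  refine (hC i hi p hp).trans ?_
  have := le_abs_self (C 0)
  have := le_abs_self (C 1)
  have := le_abs_self (C 2)
  have := abs_nonneg (C 0)
  have := abs_nonneg (C 1)
  have := abs_nonneg (C 2)
  interval_cases i <;> linarith

section generic

variable {d : ℕ} {V : Type*} [NormedAddCommGroup V] [NormedSpace ℝ V]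

/-- The space-dependent exponent as a linear functional of `(g, h)`. -/
noncomputable def Lx (A : V →L[ℝ] (EuclideanSpace ℝ (Fin d) →L[ℝ] EuclideanSpace ℝ (Fin d)))
    (σ : ℝ) (x : EuclideanSpace ℝ (Fin d)) : (EuclideanSpace ℝ (Fin d) × V) →L[ℝ] ℝ :=
  LinearMap.mkContinuous
    { toFun := fun p => -(1 / σ ^ 2) * (⟪x, A p.2 x⟫ - 2 * ⟪x, p.1⟫)
      map_add' := fun p q => by
        simp only [Prod.fst_add, Prod.snd_add, map_add, add_apply,
          inner_add_right]; ring
      map_smul' := fun a p => by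
        simp only [Prod.smul_fst, Prod.smul_snd, map_smul, smul_apply,
          inner_smul_right, smul_eq_mul, RingHom.id_apply]; ring }
    (1 / σ ^ 2 * (‖A‖ * ‖x‖ ^ 2 + 2 * ‖x‖))
    (fun p => by
      have h1 : |⟪x, A p.2 x⟫| ≤ ‖x‖ * (‖A‖ * ‖p‖ * ‖x‖) := by
        refine (abs_real_inner_le_norm _ _).trans ?_
        gcongr
        refine (ContinuousLinearMap.le_opNorm _ _).trans ?_
        gcongr
        refine (ContinuousLinearMap.le_opNorm _ _).trans ?_
        gcongr
        exact norm_snd_le p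
      have h2 : |⟪x, p.1⟫| ≤ ‖x‖ * ‖p‖ := by
        refine (abs_real_inner_le_norm _ _).trans ?_
        gcongr
        exact norm_fst_le p
      change ‖-(1 / σ ^ 2) * (⟪x, A p.2 x⟫ - 2 * ⟪x, p.1⟫)‖ ≤ _
      rw [norm_mul, norm_neg, Real.norm_of_nonneg (by positivity : 0 ≤ 1 / σ ^ 2), mul_assoc,
        Real.norm_eq_abs]
      gcongr
      rw [abs_le] at *
      constructor <;> nlinarith)

theorem Lx_apply (A : V →L[ℝ] (EuclideanSpace ℝ (Fin d) →L[ℝ] EuclideanSpace ℝ (Fin d)))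
    (σ : ℝ) (x : EuclideanSpace ℝ (Fin d)) (p : EuclideanSpace ℝ (Fin d) × V) :
    Lx A σ x p = -(1 / σ ^ 2) * (⟪x, A p.2 x⟫ - 2 * ⟪x, p.1⟫) := rfl

theorem Lx_norm (A : V →L[ℝ] (EuclideanSpace ℝ (Fin d) →L[ℝ] EuclideanSpace ℝ (Fin d)))
    (σ : ℝ) (x : EuclideanSpace ℝ (Fin d)) :
    ‖Lx A σ x‖ ≤ 1 / σ ^ 2 * (‖A‖ * ‖x‖ ^ 2 + 2 * ‖x‖) :=
  LinearMap.mkContinuous_norm_le _ (by positivity) _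

theorem scalar_bound (σ B c K m : ℝ) (hσ : 0 < σ) (hc : 0 < c) (hK : 0 ≤ K) (hm : 0 < m) :
    ∃ C : ℝ, 0 < C ∧ ∀ r : ℝ, 0 ≤ r →
      (1 + r ^ m) * ((1 + K * (1 + r ^ 2)) ^ 2 *
        Real.exp (-(1 / σ ^ 2) * (c * r ^ 2 - 2 * (B * r)))) ≤ C := by
  obtain ⟨N, hN⟩ := exists_nat_ge m
  set β := c / σ ^ 2 with hβ
  have hβp : 0 < β := by positivity
  set α := 3 + 2 * B / σ ^ 2 with hα
  refine ⟨(2 + N.factorial) * (1 + 3 * K) ^ 2 * Real.exp (α ^ 2 / (4 * β)), by positivity, ?_⟩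
  intro r hr
  have e1 : 1 ≤ Real.exp r := Real.one_le_exp hr
  have h1 : 1 + r ^ m ≤ (2 + N.factorial) * Real.exp r := by
    have hp : r ^ N ≤ N.factorial * Real.exp r := by
      have := Real.pow_div_factorial_le_exp r hr N
      rw [div_le_iff₀ (by positivity)] at this
      linarith
    have hp0 : 0 ≤ r ^ N := by positivity
    have : r ^ m ≤ 1 + r ^ N := by
      rcases le_total r 1 with h | h
      · have := Real.rpow_le_one hr h hm.le
        linarith
      · have := Real.rpow_le_rpow_of_exponent_le h hN
        rw [Real.rpow_natCast] at this
        linarith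
    nlinarith
  have h2 : 1 + K * (1 + r ^ 2) ≤ (1 + 3 * K) * Real.exp r := by
    have hp : r ^ 2 ≤ 2 * Real.exp r := by
      have := Real.pow_div_factorial_le_exp r hr 2
      norm_num [Nat.factorial] at this
      linarith
    nlinarith
  have h20 : 0 ≤ 1 + K * (1 + r ^ 2) := by positivity
  have h3 : Real.exp (3 * r + -(1 / σ ^ 2) * (c * r ^ 2 - 2 * (B * r))) ≤
      Real.exp (α ^ 2 / (4 * β)) := by
    apply Real.exp_le_exp.mpr
    have : 3 * r + -(1 / σ ^ 2) * (c * r ^ 2 - 2 * (B * r)) = α * r - β * r ^ 2 := by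
      rw [hα, hβ]; ring
    rw [this, le_div_iff₀ (by positivity)]
    nlinarith [sq_nonneg (α - 2 * β * r)]
  have h4 : Real.exp (3 * r + -(1 / σ ^ 2) * (c * r ^ 2 - 2 * (B * r))) =
      Real.exp r * (Real.exp r ^ 2 * Real.exp (-(1 / σ ^ 2) * (c * r ^ 2 - 2 * (B * r)))) := by
    rw [← Real.exp_nat_mul, ← Real.exp_add, ← Real.exp_add]
    congr 1; push_cast; ring
  calc _ ≤ ((2 + N.factorial) * Real.exp r) * (((1 + 3 * K) * Real.exp r) ^ 2 *
        Real.exp (-(1 / σ ^ 2) * (c * r ^ 2 - 2 * (B * r)))) := by gcongr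
    _ = (2 + N.factorial) * (1 + 3 * K) ^ 2 *
        Real.exp (3 * r + -(1 / σ ^ 2) * (c * r ^ 2 - 2 * (B * r))) := by rw [h4]; ring
    _ ≤ _ := by gcongr

theorem generic_cd {T : Type*} [NormedAddCommGroup T] [NormedSpace ℝ T]
    (A : V →L[ℝ] (EuclideanSpace ℝ (Fin d) →L[ℝ] EuclideanSpace ℝ (Fin d))) (σ : ℝ)
    (a : EuclideanSpace ℝ (Fin d) × V → ℝ) (U : Set (EuclideanSpace ℝ (Fin d) × V))
    (ha : ContDiffOn ℝ 2 a U) (f : T → EuclideanSpace ℝ (Fin d) × V) (hf : ContDiff ℝ 2 f)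
    (hfU : ∀ θ, f θ ∈ U) (x : EuclideanSpace ℝ (Fin d)) :
    ContDiff ℝ 2 (fun θ => a (f θ) * Real.exp (Lx A σ x (f θ))) := by
  refine ContDiff.mul ?_ (((Lx A σ x).contDiff.comp hf).exp)
  rw [← contDiffOn_univ]
  exact ha.comp hf.contDiffOn (fun θ _ => hfU θ)

theorem generic_bound {T : Type*} [NormedAddCommGroup T] [NormedSpace ℝ T]
    (A : V →L[ℝ] (EuclideanSpace ℝ (Fin d) →L[ℝ] EuclideanSpace ℝ (Fin d)))
    (σ B c m Ca : ℝ) (hσ : 0 < σ) (hc : 0 < c) (hm : 0 < m) (hCa : 0 < Ca) (hB : 0 ≤ B)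
    (a : EuclideanSpace ℝ (Fin d) × V → ℝ) (U : Set (EuclideanSpace ℝ (Fin d) × V))
    (hU : IsOpen U)
    (ha : ContDiffOn ℝ 2 a U) (f : T → EuclideanSpace ℝ (Fin d) × V) (hf : ContDiff ℝ 2 f)
    (hfU : ∀ θ, f θ ∈ U)
    (hab : ∀ θ, ∀ i ≤ 2, ‖iteratedFDerivWithin ℝ i a U (f θ)‖ ≤ Ca)
    (hfb : ∀ i ≤ 2, ∀ θ, ‖iteratedFDeriv ℝ i f θ‖ ≤ B)
    (hcoer : ∀ θ x, c * ‖x‖ ^ 2 ≤ ⟪x, A (f θ).2 x⟫) (n : ℕ) (hn : n ≤ 2) :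
    ∃ C : ℝ, 0 < C ∧ ∀ (x : EuclideanSpace ℝ (Fin d)) (θ : T),
      ‖iteratedFDeriv ℝ n (fun θ => a (f θ) * Real.exp (Lx A σ x (f θ))) θ‖ ≤
        C / (1 + ‖x‖ ^ m) := by
  set K := 1 / σ ^ 2 * (‖A‖ + 1) * B with hK
  have hK0 : 0 ≤ K := by positivity
  obtain ⟨C, hC, hCb⟩ := scalar_bound σ B c K m hσ hc hK0 hm
  have hfac : ∀ j ≤ 2, (j.factorial : ℝ) ≤ 2 := by
    intro j hj; interval_cases j <;> norm_num [Nat.factorial]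
  have hcast : ∀ j : ℕ, j ≤ 2 → (j : WithTop ℕ∞) ≤ 2 := fun j hj => by exact_mod_cast hj
  refine ⟨4 * (2 * Ca * (1 + B) ^ 2) * 2 * C, by positivity, fun x θ => ?_⟩
  set D := 1 + K * (1 + ‖x‖ ^ 2) with hD
  have hD1 : 1 ≤ D := by rw [hD]; nlinarith [mul_nonneg hK0 (sq_nonneg ‖x‖)]
  have hacd : ContDiff ℝ 2 (a ∘ f) := by
    rw [← contDiffOn_univ]
    exact ha.comp hf.contDiffOn (fun θ _ => hfU θ)
  have hLcd : ContDiff ℝ 2 (Lx A σ x ∘ f) := (Lx A σ x).contDiff.comp hf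
  have b1 : ∀ j ≤ 2, ‖iteratedFDeriv ℝ j (a ∘ f) θ‖ ≤ 2 * Ca * (1 + B) ^ 2 := by
    intro j hj
    rw [← iteratedFDerivWithin_univ]
    refine (norm_iteratedFDerivWithin_comp_le (C := Ca) (D := 1 + B) ha hf.contDiffOn (hcast j hj)
      hU.uniqueDiffOn uniqueDiffOn_univ (fun θ _ => hfU θ) (Set.mem_univ θ)
      (fun i hi => hab θ i (hi.trans hj)) ?_).trans ?_
    · intro i hi1 hi
      rw [iteratedFDerivWithin_univ]
      refine (hfb i (hi.trans hj) θ).trans ?_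
      exact (by linarith : B ≤ 1 + B).trans (le_self_pow₀ (by linarith) (by omega))
    · have := hfac j hj
      have : (1 + B) ^ j ≤ (1 + B) ^ 2 := pow_le_pow_right₀ (by linarith) hj
      gcongr
  have hLb : Lx A σ x (f θ) ≤ -(1 / σ ^ 2) * (c * ‖x‖ ^ 2 - 2 * (B * ‖x‖)) := by
    rw [Lx_apply]
    have h1 := hcoer θ x
    have h2 : ⟪x, (f θ).1⟫ ≤ B * ‖x‖ := by
      have h3 : ‖f θ‖ ≤ B := by simpa using hfb 0 (by norm_num) θ
      have h4 := (norm_fst_le (f θ)).trans h3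
      have h5 := real_inner_le_norm x (f θ).1
      nlinarith [norm_nonneg x]
    have h6 : 0 ≤ 1 / σ ^ 2 := by positivity
    nlinarith
  set Ex := Real.exp (-(1 / σ ^ 2) * (c * ‖x‖ ^ 2 - 2 * (B * ‖x‖))) with hEx
  have b2 : ∀ j ≤ 2, ‖iteratedFDeriv ℝ j (Real.exp ∘ (Lx A σ x ∘ f)) θ‖ ≤ 2 * (D ^ 2 * Ex) := by
    intro j hj
    refine (norm_iteratedFDeriv_comp_le (C := Ex) (D := D) Real.contDiff_exp hLcd (hcast j hj)
      θ ?_ ?_).trans ?_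
    · intro i hi
      rw [norm_iteratedFDeriv_eq_norm_iteratedDeriv, iteratedDeriv_eq_iterate,
        Real.iter_deriv_exp, Real.norm_of_nonneg (Real.exp_pos _).le]
      exact Real.exp_le_exp.mpr hLb
    · intro i hi1 hi
      refine le_trans ?_ (le_self_pow₀ hD1 (by omega))
      refine ((Lx A σ x).norm_iteratedFDeriv_comp_left hf.contDiffAt
        (hcast i (hi.trans hj))).trans ?_
      have h1 := Lx_norm A σ x
      have h2 : ‖A‖ * ‖x‖ ^ 2 + 2 * ‖x‖ ≤ (‖A‖ + 1) * (1 + ‖x‖ ^ 2) := by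
        nlinarith [norm_nonneg A, sq_nonneg (‖x‖ - 1)]
      calc _ ≤ (1 / σ ^ 2 * ((‖A‖ + 1) * (1 + ‖x‖ ^ 2))) * B := by
            refine mul_le_mul (h1.trans ?_) (hfb i (hi.trans hj) θ) (norm_nonneg _) (by positivity)
            gcongr
        _ ≤ D := by rw [hD, hK]; linarith
    · have h1 : D ^ j ≤ D ^ 2 := pow_le_pow_right₀ hD1 hj
      have h2 := hfac j hj
      have h3 : 0 < Ex := Real.exp_pos _
      calc _ ≤ 2 * Ex * D ^ 2 := by gcongr
        _ = _ := by ring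
  rw [le_div_iff₀ (by positivity)]
  have hprod := norm_iteratedFDeriv_mul_le hacd (Real.contDiff_exp.comp hLcd) θ (hcast n hn)
  have hsum : ∑ i ∈ Finset.range (n + 1), (n.choose i : ℝ) * ‖iteratedFDeriv ℝ i (a ∘ f) θ‖ *
      ‖iteratedFDeriv ℝ (n - i) (Real.exp ∘ (Lx A σ x ∘ f)) θ‖ ≤
      4 * (2 * Ca * (1 + B) ^ 2) * (2 * (D ^ 2 * Ex)) := by
    calc _ ≤ ∑ i ∈ Finset.range (n + 1), (n.choose i : ℝ) * (2 * Ca * (1 + B) ^ 2) *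
          (2 * (D ^ 2 * Ex)) := by
          refine Finset.sum_le_sum fun i hi => ?_
          have hi' : i ≤ 2 := by have := Finset.mem_range.mp hi; omega
          have := b1 i hi'
          have := b2 (n - i) (by omega)
          gcongr
      _ = (2 ^ n : ℝ) * (2 * Ca * (1 + B) ^ 2) * (2 * (D ^ 2 * Ex)) := by
          rw [← Finset.sum_mul, ← Finset.sum_mul]
          congr 2
          exact_mod_cast Nat.sum_range_choose n
      _ ≤ _ := by
          have h4 : (2 ^ n : ℝ) ≤ 4 := by interval_cases n <;> norm_num
          have h3 : 0 < Ex := Real.exp_pos _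
          gcongr
  have hfin := hCb ‖x‖ (norm_nonneg x)
  have hrp : 0 ≤ 1 + ‖x‖ ^ m := by positivity
  calc _ ≤ 4 * (2 * Ca * (1 + B) ^ 2) * (2 * (D ^ 2 * Ex)) * (1 + ‖x‖ ^ m) :=
        mul_le_mul_of_nonneg_right (hprod.trans hsum) hrp
    _ = 4 * (2 * Ca * (1 + B) ^ 2) * 2 * ((1 + ‖x‖ ^ m) * (D ^ 2 * Ex)) := by ring
    _ ≤ _ := by gcongr

end generic

theorem pinf_eq (d l : ℕ) (σ : ℝ)
    (g : EuclideanSpace ℝ (Fin l) → EuclideanSpace ℝ (Fin d))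
    (h : EuclideanSpace ℝ (Fin l) → Matrix (Fin d) (Fin d) ℝ)
    (x : EuclideanSpace ℝ (Fin d)) (θ : EuclideanSpace ℝ (Fin l))
    (hs : ∀ i j, h θ i j = h θ j i) (hd : 0 < (h θ).det) :
    pinf d l σ g h x θ = afun d σ (g θ, h θ) * Real.exp (Lx (Acl d) σ x (g θ, h θ)) := by
  have hL : Lx (Acl d) σ x (g θ, h θ) = -(1 / σ ^ 2) *
      (⟪x, Matrix.toEuclideanCLM (𝕜 := ℝ) (h θ) x⟫ - 2 * ⟪x, g θ⟫) := rfl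
  rw [hL]
  unfold pinf afun
  rw [mul_assoc, ← Real.exp_add]
  congr 2
  set M := h θ
  set y := Matrix.toEuclideanCLM (𝕜 := ℝ) M⁻¹ (g θ) with hy
  have hMy : Matrix.toEuclideanCLM (𝕜 := ℝ) M y = g θ := by
    rw [hy, ← mul_apply_eq_comp, ← map_mul,
      Matrix.mul_nonsing_inv _ (isUnit_iff_ne_zero.mpr hd.ne')]
    simp
  have hsym : ∀ u v, ⟪u, Matrix.toEuclideanCLM (𝕜 := ℝ) M v⟫ =
      ⟪v, Matrix.toEuclideanCLM (𝕜 := ℝ) M u⟫ := by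
    intro u v
    rw [inner_expand, inner_expand, Finset.sum_comm]
    refine Finset.sum_congr rfl fun i _ => Finset.sum_congr rfl fun j _ => ?_
    rw [hs j i]; ring
  change _ = -(1 / σ ^ 2) * ⟪g θ, y⟫ + _
  simp only [map_sub, inner_sub_left, inner_sub_right, hMy, hsym y x]
  rw [real_inner_comm y (g θ)]
  ring

/-- Under the Assumption, for `i ∈ {1, 2}` and every `m > 0` there is
`C > 0` such that the `i`-th Fréchet derivative in `θ` of `p_∞` exists and
`‖∇_θ^i p_∞(x', θ)‖ ≤ C / (1 + |x'|^m)` for all `x'` and `θ`. -/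
theorem stmt_8 (d l : ℕ) (σ : ℝ) (hσ : 0 < σ)
    (g : EuclideanSpace ℝ (Fin l) → EuclideanSpace ℝ (Fin d))
    (h : EuclideanSpace ℝ (Fin l) → Matrix (Fin d) (Fin d) ℝ)
    (hg : ContDiff ℝ 2 g) (hh : ContDiff ℝ 2 h)
    (B : ℝ)
    (hgb : ∀ i : ℕ, i ≤ 2 → ∀ θ, ‖iteratedFDeriv ℝ i g θ‖ ≤ B)
    (hhb : ∀ i : ℕ, i ≤ 2 → ∀ θ, ‖iteratedFDeriv ℝ i h θ‖ ≤ B)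
    (hsym : ∀ θ, (h θ).IsSymm)
    (c : ℝ) (hc : 0 < c)
    (hcoer : ∀ (θ : EuclideanSpace ℝ (Fin l)) (x : EuclideanSpace ℝ (Fin d)),
      c * ‖x‖ ^ 2 ≤ ⟪x, Matrix.toEuclideanCLM (𝕜 := ℝ) (h θ) x⟫) :
    (∀ x' : EuclideanSpace ℝ (Fin d), ContDiff ℝ 2 (fun θ => pinf d l σ g h x' θ)) ∧
    ∀ i ∈ ({1, 2} : Set ℕ), ∀ m : ℝ, 0 < m →
      ∃ C : ℝ, 0 < C ∧ ∀ (x' : EuclideanSpace ℝ (Fin d)) (θ : EuclideanSpace ℝ (Fin l)),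
        ‖iteratedFDeriv ℝ i (fun θ => pinf d l σ g h x' θ) θ‖ ≤ C / (1 + ‖x'‖ ^ m) := by
  have hB : 0 ≤ B := (norm_nonneg _).trans (hgb 0 (by norm_num) 0)
  have hs : ∀ θ i j, h θ i j = h θ j i := fun θ i j => ((hsym θ).apply i j).symm
  have hf : ContDiff ℝ 2 (fun θ => (g θ, h θ)) := hg.prodMk hh
  have hfb : ∀ i ≤ 2, ∀ θ, ‖iteratedFDeriv ℝ i (fun θ => (g θ, h θ)) θ‖ ≤ B := by
    intro i hi θ
    rw [iteratedFDeriv_prodMk hg.contDiffAt hh.contDiffAt (by exact_mod_cast hi),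
      ContinuousMultilinearMap.opNorm_prod]
    exact max_le (hgb i hi θ) (hhb i hi θ)
  have hK : ∀ θ, (g θ, h θ) ∈ Kset d B c := fun θ =>
    ⟨by simpa using hfb 0 (by norm_num) θ, fun x => hcoer θ x, hs θ⟩
  have hdet : ∀ θ, 0 < (h θ).det := fun θ => Kset_det d B c hc _ (hK θ)
  have heq : ∀ x, (fun θ => pinf d l σ g h x θ) =
      fun θ => afun d σ (g θ, h θ) * Real.exp (Lx (Acl d) σ x (g θ, h θ)) := fun x =>
    funext fun θ => pinf_eq d l σ g h x θ (hs θ) (hdet θ)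
  refine ⟨fun x => ?_, fun i hi m hm => ?_⟩
  · rw [heq x]
    exact generic_cd (Acl d) σ (afun d σ) _ (afun_cd d σ hσ) _ hf hdet x
  · have hi2 : i ≤ 2 := by
      rcases hi with rfl | rfl <;> norm_num
    obtain ⟨Ca, hCa, hCab⟩ := afun_bound d σ B c hσ hc
    simp only [heq]
    exact generic_bound (Acl d) σ B c m Ca hσ hc hm hCa hB (afun d σ) _ (detU_open d)
      (afun_cd d σ hσ) _ hf hdet (fun θ => hCab _ (hK θ)) hfb (fun θ x => hcoer θ x) i hi2
end

section
/- Under the Assumption, let f : ℝ^d → ℝ be measurable with |f(x)| ≤ C₀·(1 + |x|^{m₀}) for all x, for some constants C₀, m₀ > 0. Then for i ∈ {0, 1, 2} there exists a constant C > 0 such that for every θ ∈ ℝ^ℓ the i-th Fréchet derivative in θ of the map θ ↦ ∫_{ℝ^d} f(x')·p_∞(x', θ) dx' exists and satisfies ‖∇_θ^i ∫_{ℝ^d} f(x')·p_∞(x', θ) dx'‖ ≤ C. -/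
open scoped RealInnerProductSpace

attribute [local instance] Matrix.frobeniusNormedAddCommGroup Matrix.frobeniusNormedSpace

open MeasureTheory Filter Topology in
theorem gf_hasFDerivAt {X : Type} [MeasurableSpace X] {μ : Measure X}
    {E : Type} [NormedAddCommGroup E] [NormedSpace ℝ E]
    {q : X → (E →L[ℝ] ℝ)} (hq : AEStronglyMeasurable q μ)
    {F : Type} [NormedAddCommGroup F] [NormedSpace ℝ F]
    {φ : X → F} (hφ : AEStronglyMeasurable φ μ) (p : E) (ε : ℝ) (hε : 0 < ε)
    (hint : Integrable (fun x => ‖φ x‖ * Real.exp (q x p + ε * ‖q x‖)) μ) :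
    HasFDerivAt (fun p => ∫ x, Real.exp (q x p) • φ x ∂μ)
      (∫ x, Real.exp (q x p) • (q x).smulRight (φ x) ∂μ) p ∧
    Integrable (fun x => ‖(q x).smulRight (φ x)‖ * Real.exp (q x p + (ε / 2) * ‖q x‖)) μ := by
  have hqm : ∀ p', AEStronglyMeasurable (fun x => Real.exp (q x p')) μ := fun p' =>
    Real.continuous_exp.comp_aestronglyMeasurable
      ((ContinuousLinearMap.apply ℝ ℝ p').continuous.comp_aestronglyMeasurable hq)
  have hsm : AEStronglyMeasurable (fun x => (q x).smulRight (φ x)) μ :=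
    isBoundedBilinearMap_smulRight.continuous.comp_aestronglyMeasurable (hq.prodMk hφ)
  have hkey : ∀ x, ‖q x‖ * Real.exp ((ε / 2) * ‖q x‖) ≤ (2 / ε) * Real.exp (ε * ‖q x‖) := by
    intro x
    have h1 := Real.add_one_le_exp ((ε / 2) * ‖q x‖)
    have h2 : Real.exp (ε * ‖q x‖) = Real.exp ((ε / 2) * ‖q x‖) * Real.exp ((ε / 2) * ‖q x‖) := by
      rw [← Real.exp_add]; ring_nf
    have h3 : ‖q x‖ ≤ (2 / ε) * Real.exp ((ε / 2) * ‖q x‖) := by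
      rw [div_mul_eq_mul_div, le_div_iff₀ hε]; linarith
    rw [h2, ← mul_assoc]
    exact mul_le_mul_of_nonneg_right h3 (Real.exp_pos _).le
  have hI2 : Integrable
      (fun x => ‖(q x).smulRight (φ x)‖ * Real.exp (q x p + (ε / 2) * ‖q x‖)) μ := by
    refine (hint.const_mul (2 / ε)).mono' ?_ (Eventually.of_forall fun x => ?_)
    · exact hsm.norm.mul (Real.continuous_exp.comp_aestronglyMeasurable
        (((ContinuousLinearMap.apply ℝ ℝ p).continuous.comp_aestronglyMeasurable hq).add
          (hq.norm.const_mul _)))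
    · rw [Real.norm_of_nonneg (by positivity), ContinuousLinearMap.norm_smulRight_apply,
        Real.exp_add, Real.exp_add]
      have := mul_le_mul_of_nonneg_left (hkey x)
        (mul_nonneg (norm_nonneg (φ x)) (Real.exp_pos (q x p)).le)
      calc _ = ‖φ x‖ * Real.exp (q x p) * (‖q x‖ * Real.exp (ε / 2 * ‖q x‖)) := by ring
        _ ≤ _ := this
        _ = _ := by ring
  refine ⟨?_, hI2⟩
  refine hasFDerivAt_integral_of_dominated_of_fderiv_le (𝕜 := ℝ)
    (F := fun p x => Real.exp (q x p) • φ x)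
    (F' := fun p x => Real.exp (q x p) • (q x).smulRight (φ x))
    (bound := fun x => ‖(q x).smulRight (φ x)‖ * Real.exp (q x p + (ε / 2) * ‖q x‖))
    (Metric.ball_mem_nhds p (half_pos hε)) (Eventually.of_forall fun p' => (hqm p').smul hφ)
    ?_ ((hqm p).smul hsm) (Eventually.of_forall fun x p' hp' => ?_) hI2
    (Eventually.of_forall fun x p' hp' => ?_)
  · refine hint.mono' ((hqm p).smul hφ) (Eventually.of_forall fun x => ?_)
    rw [norm_smul, Real.norm_of_nonneg (Real.exp_pos _).le, mul_comm]
    gcongr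
    have := mul_nonneg hε.le (norm_nonneg (q x))
    linarith
  · rw [norm_smul, Real.norm_of_nonneg (Real.exp_pos _).le, mul_comm]
    gcongr
    have h1 : q x p' = q x p + q x (p' - p) := by rw [map_sub]; ring
    have h2 := (le_abs_self _).trans ((q x).le_opNorm (p' - p))
    have h3 : ‖p' - p‖ ≤ ε / 2 := (mem_ball_iff_norm.1 hp').le
    have h4 := mul_le_mul_of_nonneg_left h3 (norm_nonneg (q x))
    rw [h1]; linarith
  · have h1 : HasFDerivAt (fun p => Real.exp (q x p)) (Real.exp (q x p') • q x) p' :=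
      (q x).hasFDerivAt.exp
    have h2 := h1.smul_const (φ x)
    convert h2 using 1
    ext v
    simp [mul_smul]

open MeasureTheory Filter Topology in
theorem gf_contDiffOn {X : Type} [MeasurableSpace X] {μ : Measure X}
    {E : Type} [NormedAddCommGroup E] [NormedSpace ℝ E]
    {q : X → (E →L[ℝ] ℝ)} (hq : AEStronglyMeasurable q μ) {U : Set E} (hU : IsOpen U) (n : ℕ) :
    ∀ {F : Type} [NormedAddCommGroup F] [NormedSpace ℝ F]
    {φ : X → F} (_ : AEStronglyMeasurable φ μ)
    (_ : ∀ p ∈ U, ∃ ε > 0, Integrable (fun x => ‖φ x‖ * Real.exp (q x p + ε * ‖q x‖)) μ),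
    ContDiffOn ℝ n (fun p => ∫ x, Real.exp (q x p) • φ x ∂μ) U := by
  induction n with
  | zero =>
    intro F _ _ φ hφ H
    rw [Nat.cast_zero, contDiffOn_zero]
    intro p hp
    obtain ⟨ε, hε, hi⟩ := H p hp
    exact (gf_hasFDerivAt hq hφ p ε hε hi).1.continuousAt.continuousWithinAt
  | succ n ih =>
    intro F _ _ φ hφ H
    rw [Nat.cast_succ, contDiffOn_succ_iff_fderiv_of_isOpen hU]
    refine ⟨fun p hp => ?_, by simp, ?_⟩
    · obtain ⟨ε, hε, hi⟩ := H p hp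
      exact (gf_hasFDerivAt hq hφ p ε hε hi).1.differentiableAt.differentiableWithinAt
    · have hsm : AEStronglyMeasurable (fun x => (q x).smulRight (φ x)) μ :=
        isBoundedBilinearMap_smulRight.continuous.comp_aestronglyMeasurable (hq.prodMk hφ)
      refine (ih hsm fun p hp => ?_).congr fun p hp => ?_
      · obtain ⟨ε, hε, hi⟩ := H p hp
        exact ⟨ε / 2, half_pos hε, (gf_hasFDerivAt hq hφ p ε hε hi).2⟩
      · obtain ⟨ε, hε, hi⟩ := H p hp
        exact (gf_hasFDerivAt hq hφ p ε hε hi).1.fderiv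

/-- Matrices with the Frobenius norm, as a type synonym. -/
def gfM (d : ℕ) : Type := Matrix (Fin d) (Fin d) ℝ

noncomputable instance gfM_nacg (d : ℕ) : NormedAddCommGroup (gfM d) :=
  Matrix.frobeniusNormedAddCommGroup (m := Fin d) (n := Fin d) (α := ℝ)

noncomputable instance gfM_ns (d : ℕ) : NormedSpace ℝ (gfM d) :=
  Matrix.frobeniusNormedSpace (m := Fin d) (n := Fin d) (α := ℝ) (R := ℝ)

instance gfM_fd (d : ℕ) : FiniteDimensional ℝ (gfM d) :=
  (inferInstance : FiniteDimensional ℝ (Matrix (Fin d) (Fin d) ℝ))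

/-- The determinant. -/
noncomputable def gfdet {d : ℕ} (A : gfM d) : ℝ := Matrix.det (n := Fin d) (R := ℝ) A

/-- The inverse. -/
noncomputable def gfinv {d : ℕ} (A : gfM d) : gfM d :=
  (fun A : Matrix (Fin d) (Fin d) ℝ => A⁻¹) A

/-- Matrices to operators, as a continuous linear map. -/
noncomputable def gfT (d : ℕ) : gfM d →L[ℝ]
    (EuclideanSpace ℝ (Fin d) →L[ℝ] EuclideanSpace ℝ (Fin d)) :=
  LinearMap.toContinuousLinearMap
    { toFun := fun A => Matrix.toEuclideanCLM (n := Fin d) (𝕜 := ℝ) A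
      map_add' := fun A B => map_add (Matrix.toEuclideanCLM (n := Fin d) (𝕜 := ℝ)) A B
      map_smul' := fun r A => map_smul (Matrix.toEuclideanCLM (n := Fin d) (𝕜 := ℝ)) r A }

theorem gfT_apply (d : ℕ) (A : Matrix (Fin d) (Fin d) ℝ) :
    gfT d A = Matrix.toEuclideanCLM (𝕜 := ℝ) A := rfl

/-- The exponent, linear in the parameter. -/
noncomputable def gfq (d : ℕ) (σ : ℝ) (x : EuclideanSpace ℝ (Fin d)) :
    (gfM d × EuclideanSpace ℝ (Fin d)) →L[ℝ] ℝ :=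
  (-(1 / σ ^ 2)) • (((innerSL ℝ x).comp ((ContinuousLinearMap.apply ℝ _ x).comp (gfT d))).comp
      (ContinuousLinearMap.fst ℝ _ _) -
    (2 : ℝ) • (innerSL ℝ x).comp (ContinuousLinearMap.snd ℝ _ _))

theorem gfq_apply (d : ℕ) (σ : ℝ) (x : EuclideanSpace ℝ (Fin d))
    (p : gfM d × EuclideanSpace ℝ (Fin d)) :
    gfq d σ x p = -(1 / σ ^ 2) * (⟪x, gfT d p.1 x⟫ - 2 * ⟪x, p.2⟫) := rfl

theorem gfq_norm (d : ℕ) (σ : ℝ) (hσ : 0 < σ) (x : EuclideanSpace ℝ (Fin d)) :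
    ‖gfq d σ x‖ ≤ (1 / σ ^ 2) * (‖gfT d‖ * ‖x‖ ^ 2 + 2 * ‖x‖) := by
  refine ContinuousLinearMap.opNorm_le_bound _ (by positivity) fun p => ?_
  rw [gfq_apply, norm_mul, norm_neg, Real.norm_of_nonneg (by positivity : 0 ≤ 1 / σ ^ 2), mul_assoc]
  gcongr
  have h1 : ‖⟪x, gfT d p.1 x⟫‖ ≤ ‖x‖ * (‖gfT d‖ * ‖p‖ * ‖x‖) := by
    refine (norm_inner_le_norm _ _).trans ?_
    gcongr
    refine ((gfT d p.1).le_opNorm x).trans ?_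
    gcongr
    refine ((gfT d).le_opNorm _).trans ?_
    gcongr
    exact norm_fst_le p
  have h2 : ‖⟪x, p.2⟫‖ ≤ ‖x‖ * ‖p‖ := by
    refine (norm_inner_le_norm _ _).trans ?_
    gcongr
    exact norm_snd_le p
  refine (norm_sub_le _ _).trans ?_
  rw [norm_mul, Real.norm_of_nonneg (by norm_num : (0:ℝ) ≤ 2)]
  nlinarith

theorem gfq_continuous (d : ℕ) (σ : ℝ) : Continuous (gfq d σ) := by
  rw [continuous_clm_apply]
  intro p
  simp only [gfq_apply]
  fun_prop

/-- Good parameters. -/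
def gfU (d : ℕ) : Set (gfM d × EuclideanSpace ℝ (Fin d)) :=
  {p | ∃ c > 0, ∀ x, c * ‖x‖ ^ 2 ≤ ⟪x, gfT d p.1 x⟫}

theorem gfU_isOpen (d : ℕ) : IsOpen (gfU d) := by
  rw [Metric.isOpen_iff]
  rintro p ⟨c, hc, H⟩
  refine ⟨c / (2 * (‖gfT d‖ + 1)), by positivity, fun p' hp' => ⟨c / 2, by positivity, fun x => ?_⟩⟩
  have h1 : ⟪x, gfT d p'.1 x⟫ = ⟪x, gfT d p.1 x⟫ + ⟪x, gfT d (p' - p).1 x⟫ := by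
    rw [Prod.fst_sub, map_sub, sub_apply, inner_sub_right]; ring
  have h3 : ‖p' - p‖ ≤ c / (2 * (‖gfT d‖ + 1)) := (mem_ball_iff_norm.1 hp').le
  have h2 : ‖⟪x, gfT d (p' - p).1 x⟫‖ ≤ ‖x‖ * (c / 2 * ‖x‖) := by
    refine (norm_inner_le_norm _ _).trans ?_
    gcongr
    refine ((gfT d (p' - p).1).le_opNorm x).trans ?_
    gcongr
    refine ((gfT d).le_opNorm _).trans ?_
    have h4 : ‖(p' - p).1‖ ≤ c / (2 * (‖gfT d‖ + 1)) := (norm_fst_le _).trans h3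
    calc ‖gfT d‖ * ‖(p' - p).1‖ ≤ (‖gfT d‖ + 1) * (c / (2 * (‖gfT d‖ + 1))) := by
          gcongr; linarith
      _ = c / 2 := by field_simp
  have := H x
  have h5 := neg_abs_le ⟪x, gfT d (p' - p).1 x⟫
  rw [Real.norm_eq_abs] at h2
  rw [h1]
  nlinarith

theorem gfU_det (d : ℕ) {p : gfM d × EuclideanSpace ℝ (Fin d)}
    (hp : p ∈ gfU d) : gfdet p.1 ≠ 0 := by
  obtain ⟨c, hc, H⟩ := hp
  intro h0
  obtain ⟨v, hv, hv0⟩ := Matrix.exists_mulVec_eq_zero_iff.2 h0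
  have := H (WithLp.toLp 2 v)
  erw [gfT_apply, Matrix.toEuclideanCLM_toLp, hv0] at this
  simp only [WithLp.toLp_zero, inner_zero_right] at this
  have h1 : 0 < ‖(WithLp.toLp 2 v : EuclideanSpace ℝ (Fin d))‖ := by
    rw [norm_pos_iff]; simpa using hv
  have : 0 < c * ‖(WithLp.toLp 2 v : EuclideanSpace ℝ (Fin d))‖ ^ 2 := by positivity
  linarith

theorem gf_growth (m : ℝ) (hm : 0 < m) : ∃ K : ℝ, 0 < K ∧ ∀ t : ℝ, 0 ≤ t →
    1 + t ^ m ≤ K * Real.exp t := by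
  refine ⟨2 + (⌈m⌉₊.factorial : ℝ), by positivity, fun t ht => ?_⟩
  have h1 : t ^ m ≤ 1 + t ^ ⌈m⌉₊ := by
    rcases le_total t 1 with h | h
    · have := Real.rpow_le_one ht h hm.le
      have := pow_nonneg ht ⌈m⌉₊
      linarith
    · have := Real.rpow_le_rpow_of_exponent_le h (Nat.le_ceil m)
      rw [Real.rpow_natCast] at this
      linarith
  have h2 := Real.pow_div_factorial_le_exp t ht ⌈m⌉₊
  rw [div_le_iff₀ (by positivity)] at h2
  have h3 := Real.one_le_exp ht
  nlinarith

open MeasureTheory in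
theorem gf_gauss_int (d : ℕ) (a : ℝ) (ha : 0 < a) :
    Integrable (fun x : EuclideanSpace ℝ (Fin d) => Real.exp (-a * ‖x‖ ^ 2)) := by
  have := (GaussianFourier.integrable_cexp_neg_mul_sq_norm_add (V := EuclideanSpace ℝ (Fin d))
    (b := (a : ℂ)) (by simpa using ha) 0 0).norm
  refine this.congr (Filter.Eventually.of_forall fun x => ?_)
  simp only [Complex.norm_exp]
  congr 1
  simp [← Complex.ofReal_pow]

open MeasureTheory in
theorem gf_integrable (d : ℕ) (σ : ℝ) (hσ : 0 < σ)
    (f : EuclideanSpace ℝ (Fin d) → ℝ) (hf : Measurable f)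
    (C₀ m₀ : ℝ) (hC₀ : 0 < C₀) (hm₀ : 0 < m₀)
    (hfb : ∀ x : EuclideanSpace ℝ (Fin d), |f x| ≤ C₀ * (1 + ‖x‖ ^ m₀))
    (p : gfM d × EuclideanSpace ℝ (Fin d)) (hp : p ∈ gfU d) :
    ∃ ε > 0, Integrable (fun x => ‖f x‖ * Real.exp (gfq d σ x p + ε * ‖gfq d σ x‖)) := by
  obtain ⟨c, hc, H⟩ := hp
  obtain ⟨K, hK, hKt⟩ := gf_growth m₀ hm₀
  set s : ℝ := 1 / σ ^ 2 with hs
  have hs0 : 0 < s := by positivity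
  set M := ‖gfT d‖
  have hM : 0 ≤ M := norm_nonneg (gfT d)
  set ε := c / (2 * (M + 1)) with hε
  have hε0 : 0 < ε := by positivity
  set β := s * 2 * ‖p.2‖ + ε * s * 2 + 1 with hβ
  set a := s * c / 4 with ha
  have ha0 : 0 < a := by positivity
  refine ⟨ε, hε0, ?_⟩
  refine ((gf_gauss_int d a ha0).const_mul (C₀ * K * Real.exp (β ^ 2 / (4 * a)))).mono' ?_
    (Filter.Eventually.of_forall fun x => ?_)
  · refine hf.norm.aestronglyMeasurable.mul ?_
    have h1 := gfq_continuous d σ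
    exact (Real.continuous_exp.comp
      ((h1.clm_apply continuous_const).add (h1.norm.const_mul ε))).aestronglyMeasurable
  · rw [norm_mul, norm_norm, Real.norm_of_nonneg (Real.exp_pos _).le]
    have h1 : ‖f x‖ ≤ C₀ * (K * Real.exp ‖x‖) :=
      (hfb x).trans (mul_le_mul_of_nonneg_left (hKt _ (norm_nonneg x)) hC₀.le)
    have h2 : gfq d σ x p ≤ s * (-c * ‖x‖ ^ 2 + 2 * ‖p.2‖ * ‖x‖) := by
      rw [gfq_apply, ← hs, neg_mul, ← mul_neg]
      gcongr
      have := H x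
      have := real_inner_le_norm x p.2
      linarith
    have h3 := mul_le_mul_of_nonneg_left (gfq_norm d σ hσ x) hε0.le
    rw [← hs] at h3
    have h4 : ε * M ≤ c / 2 := by
      rw [hε, div_mul_eq_mul_div, div_le_iff₀ (by positivity)]
      nlinarith
    have h5 : ε * (s * (M * ‖x‖ ^ 2 + 2 * ‖x‖)) ≤ s * (c / 2) * ‖x‖ ^ 2 + ε * s * 2 * ‖x‖ := by
      have := mul_le_mul_of_nonneg_right h4 (by positivity : 0 ≤ s * ‖x‖ ^ 2)
      nlinarith
    have h6 : β * ‖x‖ ≤ a * ‖x‖ ^ 2 + β ^ 2 / (4 * a) := by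
      have : 0 ≤ (2 * a * ‖x‖ - β) ^ 2 / (4 * a) := by positivity
      have h7 : (2 * a * ‖x‖ - β) ^ 2 / (4 * a) = a * ‖x‖ ^ 2 + β ^ 2 / (4 * a) - β * ‖x‖ := by
        field_simp; ring
      linarith
    calc ‖f x‖ * Real.exp (gfq d σ x p + ε * ‖gfq d σ x‖)
        ≤ C₀ * (K * Real.exp ‖x‖) *
          Real.exp (s * (-c * ‖x‖ ^ 2 + 2 * ‖p.2‖ * ‖x‖) +
            (s * (c / 2) * ‖x‖ ^ 2 + ε * s * 2 * ‖x‖)) := by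
          gcongr
          exact h3.trans h5
      _ = C₀ * K * Real.exp (-(2 * a) * ‖x‖ ^ 2 + β * ‖x‖) := by
          rw [← mul_assoc, mul_assoc (C₀ * K), ← Real.exp_add]
          congr 2
          rw [ha, hβ]; ring
      _ ≤ C₀ * K * Real.exp (β ^ 2 / (4 * a) + -a * ‖x‖ ^ 2) := by
          refine mul_le_mul_of_nonneg_left (Real.exp_le_exp.2 ?_) (by positivity)
          linarith
      _ = _ := by rw [Real.exp_add]; ring

section
attribute [local instance] Matrix.frobeniusNormedRing Matrix.frobeniusNormedAlgebra

theorem gf_inv_contDiffAt_aux (d : ℕ) (A : Matrix (Fin d) (Fin d) ℝ) (hA : A.det ≠ 0) :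
    ContDiffAt ℝ 2 (fun A : Matrix (Fin d) (Fin d) ℝ => A⁻¹) A := by
  obtain ⟨u, rfl⟩ := (Matrix.isUnit_iff_isUnit_det A).2 (isUnit_iff_ne_zero.2 hA)
  have := contDiffAt_ringInverse ℝ (n := 2) u
  refine this.congr_of_eventuallyEq (Filter.Eventually.of_forall fun B => ?_)
  exact Matrix.nonsing_inv_eq_ringInverse (A := B)
end

theorem gf_inv_contDiffAt (d : ℕ) (A : Matrix (Fin d) (Fin d) ℝ) (hA : A.det ≠ 0) :
    ContDiffAt ℝ 2 (fun A : Matrix (Fin d) (Fin d) ℝ => A⁻¹) A :=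
  gf_inv_contDiffAt_aux d A hA

theorem gf_det_contDiff (d : ℕ) : ContDiff ℝ 2 (fun A : Matrix (Fin d) (Fin d) ℝ => A.det) := by
  have he : ∀ i j, ContDiff ℝ 2 (fun A : Matrix (Fin d) (Fin d) ℝ => A i j) := fun i j =>
    (LinearMap.toContinuousLinearMap (Matrix.entryLinearMap ℝ ℝ i j)).contDiff
  simp only [Matrix.det_apply]
  refine ContDiff.sum fun s _ => ContDiff.const_smul _ (contDiff_prod fun i _ => he _ _)

theorem gf_det_smul_inv (d : ℕ) (r : ℝ) (hr : r ≠ 0) (A : Matrix (Fin d) (Fin d) ℝ)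
    (hA : A.det ≠ 0) : (r • A⁻¹).det ≠ 0 := by
  rw [Matrix.det_smul]
  refine mul_ne_zero (pow_ne_zero _ hr) ?_
  rw [Matrix.det_nonsing_inv, Ring.inverse_eq_inv']
  exact inv_ne_zero hA

theorem gfdet_contDiff (d : ℕ) : ContDiff ℝ 2 (gfdet (d := d)) := gf_det_contDiff d

theorem gfinv_contDiffAt (d : ℕ) (A : gfM d) (hA : gfdet A ≠ 0) :
    ContDiffAt ℝ 2 (gfinv (d := d)) A := gf_inv_contDiffAt d A hA

/-- The prefactor. -/
noncomputable def gfK (d : ℕ) (σ : ℝ)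
    (p : gfM d × EuclideanSpace ℝ (Fin d)) : ℝ :=
  (gfdet ((Real.pi * σ ^ 2) • gfinv p.1)) ^ (-(1 / 2 : ℝ)) *
    Real.exp (-(1 / σ ^ 2) * ⟪gfT d (gfinv p.1) p.2, p.2⟫)

theorem gfK_contDiffOn (d : ℕ) (σ : ℝ) (hσ : 0 < σ) : ContDiffOn ℝ 2 (gfK d σ) (gfU d) := by
  intro p hp
  have hd := gfU_det d hp
  refine ContDiffAt.contDiffWithinAt ?_
  have hi : ContDiffAt ℝ 2
      (fun p : gfM d × EuclideanSpace ℝ (Fin d) => (gfinv p.1)) p :=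
    (gfinv_contDiffAt d p.1 hd).comp p contDiffAt_fst
  refine ContDiffAt.mul ?_ ?_
  · refine ContDiffAt.rpow_const_of_ne ?_ ?_
    · exact (gfdet_contDiff d).contDiffAt.comp p (hi.const_smul _)
    · exact gf_det_smul_inv d _ (by positivity) p.1 hd
  · refine ContDiffAt.exp (contDiffAt_const.mul ?_)
    refine ContDiffAt.inner ℝ ?_ contDiffAt_snd
    exact ((gfT d).contDiff.contDiffAt.comp p hi).clm_apply contDiffAt_snd

theorem gf_pinf (d l : ℕ) (σ : ℝ)
    (g : EuclideanSpace ℝ (Fin l) → EuclideanSpace ℝ (Fin d))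
    (h : EuclideanSpace ℝ (Fin l) → Matrix (Fin d) (Fin d) ℝ)
    (hsym : ∀ θ, (h θ).IsSymm) (θ : EuclideanSpace ℝ (Fin l)) (hU : ((h θ, g θ) : gfM d × EuclideanSpace ℝ (Fin d)) ∈ gfU d)
    (x : EuclideanSpace ℝ (Fin d)) :
    pinf d l σ g h x θ = gfK d σ (h θ, g θ) * Real.exp (gfq d σ x (h θ, g θ)) := by
  have hu : IsUnit (h θ).det := isUnit_iff_ne_zero.2 (gfU_det d hU)
  have hinv : gfT d (h θ) (gfT d (gfinv (h θ)) (g θ)) = g θ := by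
    change Matrix.toEuclideanCLM (𝕜 := ℝ) (h θ)
      (Matrix.toEuclideanCLM (𝕜 := ℝ) (h θ)⁻¹ (g θ)) = g θ
    rw [← mul_apply_eq_comp, ← map_mul, Matrix.mul_nonsing_inv _ hu, map_one]
    rfl
  have hsa : ∀ y z, ⟪y, gfT d (h θ) z⟫ = ⟪gfT d (h θ) y, z⟫ := by
    intro y z
    rw [real_inner_comm z, gfT_apply, Matrix.inner_toEuclideanCLM, Matrix.inner_toEuclideanCLM,
      Matrix.dotProduct_mulVec, ← Matrix.mulVec_transpose, (hsym θ).eq, dotProduct_comm]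
  have key : ⟪x - gfT d (gfinv (h θ)) (g θ), gfT d (h θ) (x - gfT d (gfinv (h θ)) (g θ))⟫ =
      ⟪gfT d (gfinv (h θ)) (g θ), g θ⟫ + (⟪x, gfT d (h θ) x⟫ - 2 * ⟪x, g θ⟫) := by
    rw [map_sub, hinv, inner_sub_left, inner_sub_right, inner_sub_right,
      hsa (gfT d (gfinv (h θ)) (g θ)) x, hinv, real_inner_comm (g θ) x]
    ring
  rw [gfK, gfq_apply, mul_assoc, ← Real.exp_add, ← mul_add]
  exact congrArg (fun t => (((Real.pi * σ ^ 2) • (h θ)⁻¹).det) ^ (-(1 / 2 : ℝ)) *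
    Real.exp (-(1 / σ ^ 2) * t)) key
/-- Under the Assumption, for measurable polynomially bounded `f`, the map
`θ ↦ ∫ f(x') p_∞(x',θ) dx'` is twice continuously differentiable and for `i ∈ {0,1,2}` its
`i`-th Fréchet derivative is uniformly bounded in `θ`. -/
theorem stmt_15 (d l : ℕ) (σ : ℝ) (hσ : 0 < σ)
    (g : EuclideanSpace ℝ (Fin l) → EuclideanSpace ℝ (Fin d))
    (h : EuclideanSpace ℝ (Fin l) → Matrix (Fin d) (Fin d) ℝ)
    (hg : ContDiff ℝ 2 g) (hh : ContDiff ℝ 2 h)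
    (B : ℝ)
    (hgb : ∀ i : ℕ, i ≤ 2 → ∀ θ, ‖iteratedFDeriv ℝ i g θ‖ ≤ B)
    (hhb : ∀ i : ℕ, i ≤ 2 → ∀ θ, ‖iteratedFDeriv ℝ i h θ‖ ≤ B)
    (hsym : ∀ θ, (h θ).IsSymm)
    (c : ℝ) (hc : 0 < c)
    (hcoer : ∀ (θ : EuclideanSpace ℝ (Fin l)) (x : EuclideanSpace ℝ (Fin d)),
      c * ‖x‖ ^ 2 ≤ ⟪x, Matrix.toEuclideanCLM (𝕜 := ℝ) (h θ) x⟫)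
    (f : EuclideanSpace ℝ (Fin d) → ℝ) (hf : Measurable f)
    (C₀ m₀ : ℝ) (hC₀ : 0 < C₀) (hm₀ : 0 < m₀)
    (hfb : ∀ x : EuclideanSpace ℝ (Fin d), |f x| ≤ C₀ * (1 + ‖x‖ ^ m₀)) :
    ContDiff ℝ 2 (fun θ : EuclideanSpace ℝ (Fin l) =>
      ∫ x' : EuclideanSpace ℝ (Fin d), f x' * pinf d l σ g h x' θ) ∧
    ∀ i ∈ ({0, 1, 2} : Set ℕ), ∃ C : ℝ, 0 < C ∧
      ∀ θ : EuclideanSpace ℝ (Fin l),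
        ‖iteratedFDeriv ℝ i (fun θ =>
          ∫ x' : EuclideanSpace ℝ (Fin d), f x' * pinf d l σ g h x' θ) θ‖ ≤ C := by
  set Φ : gfM d × EuclideanSpace ℝ (Fin d) → ℝ :=
    fun p => gfK d σ p * ∫ x, Real.exp (gfq d σ x p) • f x with hΦ
  set G : EuclideanSpace ℝ (Fin l) → gfM d × EuclideanSpace ℝ (Fin d) :=
    fun θ => (h θ, g θ) with hG
  have hGU : ∀ θ, G θ ∈ gfU d := fun θ => ⟨c, hc, fun x => hcoer θ x⟩
  have hh' : ContDiff ℝ 2 (fun θ => (h θ : gfM d)) := hh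
  have hGc : ContDiff ℝ 2 G := hh'.prodMk hg
  have hΦc : ContDiffOn ℝ 2 Φ (gfU d) := by
    refine (gfK_contDiffOn d σ hσ).mul ?_
    exact gf_contDiffOn (gfq_continuous d σ).aestronglyMeasurable (gfU_isOpen d) 2
      hf.aestronglyMeasurable (gf_integrable d σ hσ f hf C₀ m₀ hC₀ hm₀ hfb)
  have hEq : (fun θ : EuclideanSpace ℝ (Fin l) =>
      ∫ x' : EuclideanSpace ℝ (Fin d), f x' * pinf d l σ g h x' θ) = Φ ∘ G := by
    funext θ
    simp only [hΦ, hG, Function.comp]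
    rw [← MeasureTheory.integral_const_mul]
    congr 1
    funext x
    rw [gf_pinf d l σ g h hsym θ (hGU θ) x, smul_eq_mul]
    ring
  rw [hEq]
  have hB : 0 ≤ B := (norm_nonneg _).trans (hgb 0 (by norm_num) 0)
  refine ⟨contDiffOn_univ.1 (hΦc.comp hGc.contDiffOn fun θ _ => hGU θ), ?_⟩
  set S : Set (gfM d × EuclideanSpace ℝ (Fin d)) :=
    Metric.closedBall 0 B ∩ {p | ∀ x, c * ‖x‖ ^ 2 ≤ ⟪x, gfT d p.1 x⟫} with hS
  have hSc : IsCompact S := by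
    refine (isCompact_closedBall _ _).inter_right ?_
    rw [Set.ofPred_forall]
    refine isClosed_iInter fun x => isClosed_le continuous_const ?_
    fun_prop
  have hSU : S ⊆ gfU d := fun p hp => ⟨c, hc, hp.2⟩
  have hGS : ∀ θ, G θ ∈ S := by
    refine fun θ => ⟨?_, fun x => hcoer θ x⟩
    rw [mem_closedBall_zero_iff, Prod.norm_def, max_le_iff]
    have h1 := hhb 0 (by norm_num) θ
    have h2 := hgb 0 (by norm_num) θ
    rw [norm_iteratedFDeriv_zero] at h1 h2
    exact ⟨h1, h2⟩
  have hbd : ∀ i : ℕ, i ≤ 2 → ∃ C : ℝ, ∀ p ∈ S,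
      ‖iteratedFDerivWithin ℝ i Φ (gfU d) p‖ ≤ C := by
    intro i hi
    refine hSc.exists_bound_of_continuousOn ?_
    exact (hΦc.continuousOn_iteratedFDerivWithin (by exact_mod_cast hi)
      (gfU_isOpen d).uniqueDiffOn).mono hSU
  choose! C hC using hbd
  set CC := |C 0| + |C 1| + |C 2| with hCC
  have hCC' : ∀ i : ℕ, i ≤ 2 → C i ≤ CC := by
    intro i hi
    have h0 := abs_nonneg (C 0)
    have h1 := abs_nonneg (C 1)
    have h2 := abs_nonneg (C 2)
    interval_cases i
    · have := le_abs_self (C 0); linarith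
    · have := le_abs_self (C 1); linarith
    · have := le_abs_self (C 2); linarith
  have hGd : ∀ i : ℕ, i ≤ 2 → ∀ θ, ‖iteratedFDeriv ℝ i G θ‖ ≤ B := by
    have key : ∀ h' : EuclideanSpace ℝ (Fin l) → gfM d, ContDiff ℝ 2 h' →
        (∀ i : ℕ, i ≤ 2 → ∀ θ, ‖iteratedFDeriv ℝ i h' θ‖ ≤ B) → ∀ i : ℕ, i ≤ 2 → ∀ θ,
        ‖iteratedFDeriv ℝ i (fun θ => (h' θ, g θ)) θ‖ ≤ B := by
      intro h' hh' hb i hi θ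
      rw [iteratedFDeriv_prodMk hh'.contDiffAt hg.contDiffAt (by exact_mod_cast hi),
        ContinuousMultilinearMap.opNorm_prod]
      exact max_le (hb i hi θ) (hgb i hi θ)
    exact key h hh hhb
  intro i hi
  have hi2 : i ≤ 2 := by
    rcases hi with rfl | rfl | rfl <;> norm_num
  refine ⟨i.factorial * CC * (B + 1) ^ i + 1, by positivity, fun θ => ?_⟩
  rw [← iteratedFDerivWithin_univ]
  have := norm_iteratedFDerivWithin_comp_le (n := i) (x := θ) (C := CC) (D := B + 1)
    hΦc hGc.contDiffOn (by exact_mod_cast hi2) (gfU_isOpen d).uniqueDiffOn uniqueDiffOn_univ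
    (fun θ _ => hGU θ) (Set.mem_univ θ)
    (fun j hj => (hC j (hj.trans hi2) _ (hGS θ)).trans (hCC' j (hj.trans hi2)))
    (fun j hj1 hj => by
      rw [iteratedFDerivWithin_univ]
      refine (hGd j (hj.trans hi2) θ).trans ?_
      have := le_self_pow₀ (by linarith : 1 ≤ B + 1) (by omega : j ≠ 0)
      linarith)
  linarith
end
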